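/- Let Ω ⊆ ℝ² be open, let N : Ω → ℝ³ be C² with ‖N(p)‖ = 1 for all p, and let f : Ω → ℝ³ be C² with f_x = N × N_y and f_y = −N × N_x on Ω. Then at every point p where f is an immersion, the Gauss curvature of f with respect to the unit normal N equals 1; that is, ⟨f_xx,N⟩⟨f_yy,N⟩ − ⟨f_xy,N⟩² = ⟨f_x,f_x⟩⟨f_y,f_y⟩ − ⟨f_x,f_y⟩² at every such point. -/

import Mathlib

noncomputable section

open Real

/-- Euclidean dot product on `ℝ³`. -/
def dot3 (u v : Fin 3 → ℝ) : ℝ := u 0 * v 0 + u 1 * v 1 + u 2 * v 2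

/-- Cross product on `ℝ³`. -/
def cross3 (u v : Fin 3 → ℝ) : Fin 3 → ℝ :=
  ![u 1 * v 2 - u 2 * v 1, u 2 * v 0 - u 0 * v 2, u 0 * v 1 - u 1 * v 0]

/-- Euclidean norm on `ℝ³`. -/
def norm3 (u : Fin 3 → ℝ) : ℝ := Real.sqrt (dot3 u u)

/-- Partial derivative in the first (x) coordinate direction. -/
def px (f : ℝ × ℝ → Fin 3 → ℝ) (p : ℝ × ℝ) : Fin 3 → ℝ := fderiv ℝ f p (1, 0)

/-- Partial derivative in the second (y) coordinate direction. -/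
def py (f : ℝ × ℝ → Fin 3 → ℝ) (p : ℝ × ℝ) : Fin 3 → ℝ := fderiv ℝ f p (0, 1)

/-- Gauss curvature of `g` with respect to the unit normal field `ν`:
`K = (l·n − m²)/(E·G − F²)`. -/
def GaussK (g ν : ℝ × ℝ → Fin 3 → ℝ) (p : ℝ × ℝ) : ℝ :=
  (dot3 (px (px g) p) (ν p) * dot3 (py (py g) p) (ν p) - dot3 (py (px g) p) (ν p) ^ 2) /
    (dot3 (px g p) (px g p) * dot3 (py g p) (py g p) - dot3 (px g p) (py g p) ^ 2)

/-- Mean curvature of `g` with respect to the unit normal field `ν`: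
`H = (E·n − 2F·m + G·l)/(2(E·G − F²))`. -/
def MeanH (g ν : ℝ × ℝ → Fin 3 → ℝ) (p : ℝ × ℝ) : ℝ :=
  (dot3 (px g p) (px g p) * dot3 (py (py g) p) (ν p)
      - 2 * dot3 (px g p) (py g p) * dot3 (py (px g) p) (ν p)
      + dot3 (py g p) (py g p) * dot3 (px (px g) p) (ν p)) /
    (2 * (dot3 (px g p) (px g p) * dot3 (py g p) (py g p) - dot3 (px g p) (py g p) ^ 2))

theorem dot3_comm (u v : Fin 3 → ℝ) : dot3 u v = dot3 v u := by
  simp only [dot3]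
  ring

theorem dot3_neg_left (u v : Fin 3 → ℝ) : dot3 (-u) v = -dot3 u v := by
  simp only [dot3, Pi.neg_apply]
  ring

theorem dot3_neg_right (u v : Fin 3 → ℝ) : dot3 u (-v) = -dot3 u v := by
  rw [dot3_comm, dot3_neg_left, dot3_comm]

theorem dot3_self_eq_zero {u : Fin 3 → ℝ} : dot3 u u = 0 ↔ u = 0 := by
  rw [← dotProduct_self_eq_zero, dotProduct, Fin.sum_univ_three, dot3]

theorem dot3_cross3_cross3 (a b c d : Fin 3 → ℝ) :
    dot3 (cross3 a b) (cross3 c d) = dot3 a c * dot3 b d - dot3 a d * dot3 b c := by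
  simp [dot3, cross3]
  ring

theorem dot3_cross3_self_left (u v : Fin 3 → ℝ) : dot3 (cross3 u v) u = 0 := by
  simp [dot3, cross3]
  ring

theorem dot3_cross3_self_right (u v : Fin 3 → ℝ) : dot3 (cross3 u v) v = 0 := by
  simp [dot3, cross3]
  ring

theorem dot3_cross3_swap (u v w : Fin 3 → ℝ) :
    dot3 (cross3 u v) w = -dot3 (cross3 u w) v := by
  simp [dot3, cross3]
  ring

/-- The square of the triple product of three vectors is their Gram determinant. -/
theorem dot3_cross3_sq (n a b : Fin 3 → ℝ) :
    dot3 (cross3 n a) b ^ 2 =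
      dot3 n n * (dot3 a a * dot3 b b - dot3 a b ^ 2)
        - dot3 n a * (dot3 n a * dot3 b b - dot3 a b * dot3 n b)
        + dot3 n b * (dot3 n a * dot3 a b - dot3 a a * dot3 n b) := by
  simp [dot3, cross3]
  ring

theorem fderiv_dot3_apply {u v : ℝ × ℝ → Fin 3 → ℝ} {p : ℝ × ℝ}
    (hu : DifferentiableAt ℝ u p) (hv : DifferentiableAt ℝ v p) (w : ℝ × ℝ) :
    fderiv ℝ (fun q ↦ dot3 (u q) (v q)) p w =
      dot3 (fderiv ℝ u p w) (v p) + dot3 (u p) (fderiv ℝ v p w) := by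
  have hui := hasFDerivAt_pi'.1 hu.hasFDerivAt
  have hvi := hasFDerivAt_pi'.1 hv.hasFDerivAt
  have h := (((hui 0).mul (hvi 0)).add ((hui 1).mul (hvi 1))).add ((hui 2).mul (hvi 2))
  have h' : HasFDerivAt (fun q ↦ dot3 (u q) (v q)) _ p := h
  rw [h'.fderiv]
  simp [dot3]
  ring

/-- Leibniz rule for a pair of maps whose dot product is constant on an open set. -/
theorem dot3_fderiv_of_dot3_eq_const {Ω : Set (ℝ × ℝ)} (hΩ : IsOpen Ω)
    {u v : ℝ × ℝ → Fin 3 → ℝ} {c : ℝ} (h : ∀ q ∈ Ω, dot3 (u q) (v q) = c) {p : ℝ × ℝ}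
    (hp : p ∈ Ω) (hu : DifferentiableAt ℝ u p) (hv : DifferentiableAt ℝ v p) (w : ℝ × ℝ) :
    dot3 (fderiv ℝ u p w) (v p) = -dot3 (u p) (fderiv ℝ v p w) := by
  have hc : (fun q ↦ dot3 (u q) (v q)) =ᶠ[nhds p] fun _ ↦ c :=
    Filter.eventually_of_mem (hΩ.mem_nhds hp) h
  have key := fderiv_dot3_apply hu hv w
  rw [hc.fderiv_eq, fderiv_fun_const] at key
  simp only [Pi.zero_apply, zero_apply] at key
  linarith

theorem differentiableAt_fderiv_apply {f : ℝ × ℝ → Fin 3 → ℝ} {p : ℝ × ℝ}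
    (hf : ContDiffAt ℝ 2 f p) (w : ℝ × ℝ) :
    DifferentiableAt ℝ (fun q ↦ fderiv ℝ f q w) p := by
  have h : ContDiffAt ℝ 1 (fderiv ℝ f) p := hf.fderiv_right (by norm_num)
  exact (h.differentiableAt (by norm_num)).clm_apply (differentiableAt_const w)

/-- a spherical frontal has Gauss curvature `1` at every immersed point:
`l·n − m² = E·G − F²`. -/
theorem stmt8 (Ω : Set (ℝ × ℝ)) (hΩ : IsOpen Ω)
    (N f : ℝ × ℝ → Fin 3 → ℝ)
    (hN : ContDiffOn ℝ 2 N Ω) (hf : ContDiffOn ℝ 2 f Ω)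
    (hunit : ∀ p ∈ Ω, norm3 (N p) = 1)
    (heq : ∀ p ∈ Ω, px f p = cross3 (N p) (py N p) ∧ py f p = -(cross3 (N p) (px N p))) :
    ∀ p ∈ Ω, cross3 (px f p) (py f p) ≠ 0 →
      GaussK f N p = 1 ∧
      dot3 (px (px f) p) (N p) * dot3 (py (py f) p) (N p) - dot3 (py (px f) p) (N p) ^ 2 =
        dot3 (px f p) (px f p) * dot3 (py f p) (py f p) - dot3 (px f p) (py f p) ^ 2 := by
  intro p hp himm
  have hNp : DifferentiableAt ℝ N p :=
    (hN.contDiffAt (hΩ.mem_nhds hp)).differentiableAt (by norm_num)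
  have hfp := hf.contDiffAt (hΩ.mem_nhds hp)
  have hNN : ∀ q ∈ Ω, dot3 (N q) (N q) = 1 := fun q hq ↦ Real.sqrt_eq_one.1 (hunit q hq)
  have hfxN : ∀ q ∈ Ω, dot3 (px f q) (N q) = 0 := fun q hq ↦ by
    rw [(heq q hq).1, dot3_cross3_self_left]
  have hfyN : ∀ q ∈ Ω, dot3 (py f q) (N q) = 0 := fun q hq ↦ by
    rw [(heq q hq).2, dot3_neg_left, dot3_cross3_self_left, neg_zero]
  have hNw : ∀ w, dot3 (N p) (fderiv ℝ N p w) = 0 := fun w ↦ by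
    have h := dot3_fderiv_of_dot3_eq_const hΩ hNN hp hNp hNp w
    rw [dot3_comm] at h
    linarith
  have hNx : dot3 (N p) (px N p) = 0 := hNw _
  have hNy : dot3 (N p) (py N p) = 0 := hNw _
  have hdx : DifferentiableAt ℝ (px f) p := differentiableAt_fderiv_apply hfp _
  have hdy : DifferentiableAt ℝ (py f) p := differentiableAt_fderiv_apply hfp _
  have hl : dot3 (px (px f) p) (N p) = -dot3 (px f p) (px N p) :=
    dot3_fderiv_of_dot3_eq_const hΩ hfxN hp hdx hNp _
  have hm : dot3 (py (px f) p) (N p) = -dot3 (px f p) (py N p) :=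
    dot3_fderiv_of_dot3_eq_const hΩ hfxN hp hdx hNp _
  have hn : dot3 (py (py f) p) (N p) = -dot3 (py f p) (py N p) :=
    dot3_fderiv_of_dot3_eq_const hΩ hfyN hp hdy hNp _
  have hmain : dot3 (px (px f) p) (N p) * dot3 (py (py f) p) (N p)
      - dot3 (py (px f) p) (N p) ^ 2 =
        dot3 (px f p) (px f p) * dot3 (py f p) (py f p) - dot3 (px f p) (py f p) ^ 2 := by
    have hgram := dot3_cross3_sq (N p) (px N p) (py N p)
    rw [hNN p hp, hNx, hNy] at hgram
    rw [hl, hm, hn, (heq p hp).1, (heq p hp).2, dot3_cross3_self_right,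
      dot3_cross3_swap (N p) (py N p) (px N p)]
    simp only [dot3_neg_left, dot3_neg_right, dot3_cross3_cross3, hNN p hp, hNx, hNy,
      dot3_comm (py N p) (px N p), dot3_comm (px N p) (N p), dot3_comm (py N p) (N p)]
    linear_combination hgram
  refine ⟨?_, hmain⟩
  have hne : dot3 (px f p) (px f p) * dot3 (py f p) (py f p) - dot3 (px f p) (py f p) ^ 2 ≠ 0 := by
    have h := mt dot3_self_eq_zero.1 himm
    rwa [dot3_cross3_cross3, dot3_comm (py f p) (px f p), ← sq] at h
  rw [GaussK, hmain, div_self hne]
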